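/- arXiv:math/0304103 — 5 statements merged into one kernel-verified Lean document; each statement's English description precedes it below -/
import Mathlib

section
/- Let n, m ≥ 1 and let ω ∈ ℝⁿ, Ω ∈ ℝᵐ be equipped with a resonance structure (m̂, n̂, ω̂, (M_j), (a_j)) with 1 ≤ m̂ ≤ m. Assume M_j ≥ m̂ for all 1 ≤ j ≤ m̂, and, in the case m̂ = 1 and M₁ = 1, assume additionally that there exists n+1 ≤ i* ≤ n̂ with a_{1,i*} ≠ 0. Set β := 2 max_{1≤j≤m̂} |a_j|₁, d₀ := min{1/(2β), 1/(4 max_{1≤j≤m̂} M_j)} and M := lcm(M₁, …, M_m̂). Then for every 0 < δ ≤ 1/(2β) and every t₀ > 0 there exists τ ≥ t₀ with τ − t₀ ≤ T_erg(ω̂/M, δ/M) such that dist(ω_i τ, ℤ) ≤ δ for all 1 ≤ i ≤ n and dist(Ω_j τ, ℤ) ≥ d₀ for all 1 ≤ j ≤ m. -/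
open Real

/-- dist(x, ℤ) -/
noncomputable def distZ (x : ℝ) : ℝ := ⨅ p : ℤ, |x - (p : ℝ)|

/-- set of times t ≥ 0 within which the linear flow s ↦ sξ fills 𝕋^d within ε -/
def ergTimeSet (d : ℕ) (ξ : Fin d → ℝ) (ε : ℝ) : Set ℝ :=
  {t | 0 ≤ t ∧ ∀ x : Fin d → ℝ, ∃ s ∈ Set.Icc (0 : ℝ) t, ∃ h : Fin d → ℤ,
      ∀ i, |x i - s * ξ i - (h i : ℝ)| ≤ ε}

/-- the ergodization time T_erg(ξ, ε) ∈ [0, ∞] -/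
noncomputable def Terg (d : ℕ) (ξ : Fin d → ℝ) (ε : ℝ) : ENNReal :=
  ⨅ t ∈ ergTimeSet d ξ ε, ENNReal.ofReal t

open MeasureTheory Filter Topology

/-- The linear flow `s ↦ s ξ` on the torus. -/
noncomputable def torusFlow {ι : Type*} (ξ : ι → ℝ) (s : ℝ) : UnitAddTorus ι :=
  fun i => ((s * ξ i : ℝ) : UnitAddCircle)

lemma continuous_torusFlow {ι : Type*} (ξ : ι → ℝ) : Continuous (torusFlow ξ) :=
  continuous_pi fun _ =>
    (AddCircle.continuous_mk' (1 : ℝ)).comp (continuous_id.mul continuous_const)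

lemma mFourier_torusFlow {ι : Type*} [Fintype ι] (ξ : ι → ℝ) (ℓ : ι → ℤ) (s : ℝ) :
    UnitAddTorus.mFourier ℓ (torusFlow ξ s) =
      Complex.exp (2 * π * Complex.I * (∑ i, (ℓ i : ℝ) * ξ i : ℝ) * s) := by
  simp only [UnitAddTorus.mFourier, torusFlow, ContinuousMap.coe_mk, fourier_coe_apply,
    ← Complex.exp_sum]
  congr 1
  push_cast
  rw [Finset.mul_sum, Finset.sum_mul]
  refine Finset.sum_congr rfl fun i _ => ?_
  ring

/-- Characters of the torus integrate to zero unless they are constant along the flow. -/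
lemma integral_mFourier_eq_zero {ι : Type*} [Fintype ι] (ξ : ι → ℝ) (ℓ : ι → ℤ)
    (hℓ : ∑ i, (ℓ i : ℝ) * ξ i ≠ 0)
    (μ : Measure (UnitAddTorus ι)) [μ.IsAddLeftInvariant] :
    ∫ θ, UnitAddTorus.mFourier ℓ θ ∂μ = 0 := by
  set c : ℝ := ∑ i, (ℓ i : ℝ) * ξ i with hc
  have hval : UnitAddTorus.mFourier ℓ (torusFlow ξ (1 / (2 * c))) = -1 := by
    rw [mFourier_torusFlow, ← hc, ← Complex.exp_pi_mul_I]
    congr 1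
    have : (c : ℂ) ≠ 0 := by exact_mod_cast hℓ
    push_cast
    field_simp
  have hmul : ∀ θ, UnitAddTorus.mFourier ℓ (torusFlow ξ (1 / (2 * c)) + θ) =
      -UnitAddTorus.mFourier ℓ θ := by
    intro θ
    have : UnitAddTorus.mFourier ℓ (torusFlow ξ (1 / (2 * c)) + θ) =
        UnitAddTorus.mFourier ℓ (torusFlow ξ (1 / (2 * c))) * UnitAddTorus.mFourier ℓ θ := by
      simp only [UnitAddTorus.mFourier, ContinuousMap.coe_mk, Pi.add_apply, fourier_apply,
        smul_add, AddCircle.toCircle_add, Circle.coe_mul, Finset.prod_mul_distrib]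
    rw [this, hval, neg_one_mul]
  have h := integral_add_left_eq_self (μ := μ) (fun θ => UnitAddTorus.mFourier ℓ θ)
    (torusFlow ξ (1 / (2 * c)))
  simp only [hmul, integral_neg] at h
  exact self_eq_neg.mp h.symm

/-- Time average of a function along the flow over `[0, T]`. -/
noncomputable def timeMean {ι : Type*} (ξ : ι → ℝ) (g : UnitAddTorus ι → ℂ) (T : ℝ) : ℂ :=
  (T : ℂ)⁻¹ * ∫ s in (0 : ℝ)..T, g (torusFlow ξ s)

lemma tendsto_timeMean_mFourier {ι : Type*} [Fintype ι] (ξ : ι → ℝ) (ℓ : ι → ℤ)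
    (hℓ : ∑ i, (ℓ i : ℝ) * ξ i ≠ 0) :
    Tendsto (timeMean ξ (UnitAddTorus.mFourier ℓ)) atTop (𝓝 0) := by
  set c : ℝ := ∑ i, (ℓ i : ℝ) * ξ i with hc
  have hc' : (2 * π * Complex.I * c : ℂ) ≠ 0 := by
    have : (c : ℂ) ≠ 0 := by exact_mod_cast hℓ
    simp [this, Real.pi_ne_zero]
  have hbound : ∀ T : ℝ, 0 < T → ‖timeMean ξ (UnitAddTorus.mFourier ℓ) T‖ ≤
      T⁻¹ * (2 / ‖(2 * π * Complex.I * c : ℂ)‖) := by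
    intro T hT
    simp only [timeMean, mFourier_torusFlow, ← hc]
    rw [integral_exp_mul_complex hc', norm_mul, norm_div, norm_inv, Complex.norm_real,
      Real.norm_of_nonneg hT.le]
    gcongr
    refine (norm_sub_le _ _).trans ?_
    have h1 : ∀ s : ℝ, ‖Complex.exp (2 * π * Complex.I * c * s)‖ = 1 := by
      intro s
      rw [show (2 * π * Complex.I * c * s : ℂ) = ((2 * π * c * s : ℝ) : ℂ) * Complex.I by
        push_cast; ring]
      exact Complex.norm_exp_ofReal_mul_I _
    rw [h1, h1]
    norm_num
  refine squeeze_zero_norm' ((eventually_gt_atTop 0).mono hbound) ?_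
  simpa using (tendsto_inv_atTop_zero (𝕜 := ℝ)).mul_const (2 / ‖(2 * π * Complex.I * c : ℂ)‖)

lemma intervalIntegrable_comp_torusFlow {ι : Type*} [Fintype ι] (ξ : ι → ℝ)
    (g : C(UnitAddTorus ι, ℂ)) (a b : ℝ) :
    IntervalIntegrable (fun s => g (torusFlow ξ s)) volume a b :=
  (g.continuous.comp (continuous_torusFlow ξ)).intervalIntegrable a b

/-- **Weyl equidistribution** for rationally independent linear flows on the torus. -/
theorem tendsto_timeMean {ι : Type*} [Fintype ι] (ξ : ι → ℝ)
    (hξ : ∀ ℓ : ι → ℤ, ℓ ≠ 0 → ∑ i, (ℓ i : ℝ) * ξ i ≠ 0)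
    (μ : Measure (UnitAddTorus ι)) [μ.IsAddLeftInvariant] [IsProbabilityMeasure μ]
    (g : C(UnitAddTorus ι, ℂ)) :
    Tendsto (timeMean ξ g) atTop (𝓝 (∫ θ, g θ ∂μ)) := by
  have hint : ∀ g : C(UnitAddTorus ι, ℂ), Integrable g μ := fun g =>
    Integrable.of_bound g.continuous.aestronglyMeasurable ‖g‖
      (Eventually.of_forall g.norm_coe_le_norm)
  have hspan : ∀ p ∈ Submodule.span ℂ (Set.range (UnitAddTorus.mFourier (d := ι))),
      Tendsto (timeMean ξ p) atTop (𝓝 (∫ θ, p θ ∂μ)) := by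
    intro p hp
    induction hp using Submodule.span_induction with
    | mem p hp =>
      obtain ⟨ℓ, rfl⟩ := hp
      by_cases h0 : ℓ = 0
      · subst h0
        refine tendsto_const_nhds.congr' ?_
        filter_upwards [eventually_gt_atTop 0] with T hT
        have : (T : ℂ) ≠ 0 := by exact_mod_cast hT.ne'
        simp [timeMean, UnitAddTorus.mFourier_zero, this]
      · rw [integral_mFourier_eq_zero ξ ℓ (hξ ℓ h0)]
        exact tendsto_timeMean_mFourier ξ ℓ (hξ ℓ h0)
    | zero =>
      have h : timeMean ξ (0 : C(UnitAddTorus ι, ℂ)) = fun _ => 0 := by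
        funext T
        simp [timeMean]
      rw [h]
      simp
    | add p q _ _ hp hq =>
      have h := hp.add hq
      rw [← integral_add (hint p) (hint q)] at h
      refine h.congr fun T => ?_
      simp only [timeMean, ContinuousMap.add_apply]
      rw [intervalIntegral.integral_add (intervalIntegrable_comp_torusFlow ξ p 0 T)
        (intervalIntegrable_comp_torusFlow ξ q 0 T), mul_add]
    | smul c p _ hp =>
      have h := hp.const_mul c
      rw [← integral_const_mul] at h
      refine h.congr fun T => ?_
      simp only [timeMean, ContinuousMap.smul_apply, smul_eq_mul,
        intervalIntegral.integral_const_mul]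
      ring
  rw [Metric.tendsto_nhds]
  intro ε hε
  obtain ⟨p, hp, hgp⟩ : ∃ p ∈ Submodule.span ℂ (Set.range (UnitAddTorus.mFourier (d := ι))),
      dist g p < ε / 3 := by
    refine Metric.mem_closure_iff.mp ?_ (ε / 3) (by positivity)
    rw [← Submodule.topologicalClosure_coe, UnitAddTorus.span_mFourier_closure_eq_top]
    trivial
  have hpt : ∀ θ, ‖g θ - p θ‖ ≤ ε / 3 := fun θ => by
    rw [← dist_eq_norm]
    exact (ContinuousMap.dist_apply_le_dist θ).trans hgp.le
  have hspace : dist (∫ θ, p θ ∂μ) (∫ θ, g θ ∂μ) ≤ ε / 3 := by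
    rw [dist_comm, dist_eq_norm, ← integral_sub (hint g) (hint p)]
    simpa using norm_integral_le_of_norm_le_const (μ := μ) (Eventually.of_forall hpt)
  filter_upwards [Metric.tendsto_nhds.mp (hspan p hp) (ε / 3) (by positivity),
    eventually_gt_atTop 0] with T hT hT0
  have htime : dist (timeMean ξ g T) (timeMean ξ p T) ≤ ε / 3 := by
    rw [dist_eq_norm, timeMean, timeMean, ← mul_sub,
      ← intervalIntegral.integral_sub (intervalIntegrable_comp_torusFlow ξ g 0 T)
        (intervalIntegrable_comp_torusFlow ξ p 0 T), norm_mul, norm_inv, Complex.norm_real,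
      Real.norm_of_nonneg hT0.le]
    have h := intervalIntegral.norm_integral_le_of_norm_le_const (a := 0) (b := T)
      (f := fun s => g (torusFlow ξ s) - p (torusFlow ξ s)) (fun s _ => hpt (torusFlow ξ s))
    rw [sub_zero, abs_of_pos hT0] at h
    calc T⁻¹ * _ ≤ T⁻¹ * (ε / 3 * T) := by gcongr
      _ = ε / 3 := by field_simp
  calc dist (timeMean ξ g T) (∫ θ, g θ ∂μ) ≤
      dist (timeMean ξ g T) (timeMean ξ p T) + dist (timeMean ξ p T) (∫ θ, p θ ∂μ) +
        dist (∫ θ, p θ ∂μ) (∫ θ, g θ ∂μ) := dist_triangle4 _ _ _ _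
    _ < ε := by linarith

/-- **Kronecker's theorem** for rationally independent linear flows. -/
theorem exists_time_near {ι : Type*} [Fintype ι] (ξ : ι → ℝ)
    (hξ : ∀ ℓ : ι → ℤ, ℓ ≠ 0 → ∑ i, (ℓ i : ℝ) * ξ i ≠ 0) {ε : ℝ} (hε : 0 < ε) (x : ι → ℝ) :
    ∃ s : ℝ, 0 ≤ s ∧ ∃ h : ι → ℤ, ∀ i, |x i - s * ξ i - (h i : ℝ)| ≤ ε := by
  set X : UnitAddTorus ι := fun i => ((x i : ℝ) : UnitAddCircle) with hX
  suffices h : ∃ s : ℝ, 0 ≤ s ∧ dist X (torusFlow ξ s) < ε by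
    obtain ⟨s, hs, hd⟩ := h
    refine ⟨s, hs, fun i => round (x i - s * ξ i), fun i => ?_⟩
    have h := ((dist_pi_lt_iff hε).mp hd i).le
    rwa [dist_eq_norm, hX, torusFlow, ← AddCircle.coe_sub, UnitAddCircle.norm_eq] at h
  by_contra! hfar
  let f : UnitAddTorus ι → ℝ := fun θ => max 0 (ε - dist X θ)
  have hf : Continuous f := by fun_prop
  let μ : Measure (UnitAddTorus ι) := Measure.addHaarMeasure ⊤
  have : IsProbabilityMeasure μ := ⟨by
    rw [← TopologicalSpace.PositiveCompacts.coe_top]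
    exact Measure.addHaarMeasure_self⟩
  have hpos : 0 < ∫ θ, f θ ∂μ :=
    hf.integral_pos_of_hasCompactSupport_nonneg_nonzero (HasCompactSupport.of_compactSpace f)
      (fun θ => le_max_left _ _) (x := X) (by simp [f, hε.ne', hε.le])
  let g : C(UnitAddTorus ι, ℂ) := ⟨fun θ => (f θ : ℂ), by fun_prop⟩
  have hlim := tendsto_timeMean ξ hξ μ g
  have hzero : ∀ᶠ T in atTop, timeMean ξ g T = 0 := by
    filter_upwards [eventually_ge_atTop 0] with T hT
    rw [timeMean, intervalIntegral.integral_congr (g := fun _ => (0 : ℂ))]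
    · simp
    · intro s hs
      rw [Set.uIcc_of_le hT] at hs
      simp [g, f, hfar s hs.1]
  have := tendsto_nhds_unique hlim ((tendsto_congr' hzero).mpr tendsto_const_nhds)
  rw [show (∫ θ, g θ ∂μ) = ((∫ θ, f θ ∂μ : ℝ) : ℂ) from integral_ofReal] at this
  exact hpos.ne' (by exact_mod_cast this)

/-- The ergodization time is attained: every target is approached within time `Terg`. -/
theorem exists_time_le_Terg {d : ℕ} (ξ : Fin d → ℝ)
    (hξ : ∀ ℓ : Fin d → ℤ, ℓ ≠ 0 → ∑ i, (ℓ i : ℝ) * ξ i ≠ 0) {ε : ℝ} (hε : 0 < ε)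
    (x : Fin d → ℝ) :
    ∃ s : ℝ, 0 ≤ s ∧ ENNReal.ofReal s ≤ Terg d ξ ε ∧
      ∃ h : Fin d → ℤ, ∀ i, |x i - s * ξ i - (h i : ℝ)| ≤ ε := by
  let S : Set ℝ := {s | 0 ≤ s ∧ ∀ i, |x i - s * ξ i - (round (x i - s * ξ i) : ℝ)| ≤ ε}
  have hS : ∀ s : ℝ, 0 ≤ s → (∃ h : Fin d → ℤ, ∀ i, |x i - s * ξ i - (h i : ℝ)| ≤ ε) → s ∈ S :=
    fun s hs ⟨h, hh⟩ => ⟨hs, fun i => (round_le _ _).trans (hh i)⟩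
  have hclosed : IsClosed S := by
    have : S = Set.Ici 0 ∩ ⋂ i, {s : ℝ | ‖((x i - s * ξ i : ℝ) : UnitAddCircle)‖ ≤ ε} := by
      ext s
      simp only [S, UnitAddCircle.norm_eq, Set.mem_ofPred_eq, Set.mem_inter_iff, Set.mem_Ici,
        Set.mem_iInter]
    rw [this]
    refine isClosed_Ici.inter (isClosed_iInter fun i => isClosed_le ?_ continuous_const)
    exact ((AddCircle.continuous_mk' (1 : ℝ)).comp (by fun_prop)).norm
  have hbdd : BddBelow S := ⟨0, fun s hs => hs.1⟩
  have hne : S.Nonempty := by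
    obtain ⟨s, hs, h⟩ := exists_time_near ξ hξ hε x
    exact ⟨s, hS s hs h⟩
  have hmem := hclosed.csInf_mem hne hbdd
  refine ⟨sInf S, hmem.1, ?_, fun i => round (x i - sInf S * ξ i), hmem.2⟩
  refine le_iInf₂ fun t ht => ENNReal.ofReal_le_ofReal ?_
  obtain ⟨s, hs, h⟩ := ht.2 x
  exact (csInf_le hbdd (hS s hs.1 h)).trans hs.2
open scoped Pointwise

/-- Finitely many proper homogeneous congruences with moduli at least their number
can be violated simultaneously. -/
lemma exists_forall_not_dvd {J ι : Type*} [Fintype J] [Fintype ι] (N : J → ℕ) (a : J → ι → ℤ)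
    (hN : ∀ j, 2 ≤ N j) (hcard : ∀ j, Fintype.card J ≤ N j)
    (hgcd : ∀ j, Int.gcd (Finset.gcd Finset.univ (a j)) (N j : ℤ) = 1) :
    ∃ k : ι → ℤ, ∀ j, ¬ (N j : ℤ) ∣ ∑ i, a j i * k i := by
  classical
  let φ : ∀ j, (ι → ℤ) →+ ZMod (N j) := fun j =>
    AddMonoidHom.mk' (fun k => ((∑ i, a j i * k i : ℤ) : ZMod (N j))) fun k l => by
      simp only [Pi.add_apply, mul_add, Finset.sum_add_distrib, Int.cast_add]
  have hφ : ∀ j k, φ j k = ((∑ i, a j i * k i : ℤ) : ZMod (N j)) := fun _ _ => rfl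
  have hindex : ∀ j, (φ j).ker.index = N j := by
    intro j
    have hsurj : Function.Surjective (φ j) := by
      intro z
      obtain ⟨z, rfl⟩ := ZMod.intCast_surjective z
      obtain ⟨u, hu⟩ := Finset.gcd_eq_sum_mul Finset.univ (a j)
      have hbez := Int.gcd_eq_gcd_ab (Finset.gcd Finset.univ (a j)) (N j : ℤ)
      rw [hgcd j] at hbez
      set A := Int.gcdA (Finset.gcd Finset.univ (a j)) (N j : ℤ)
      refine ⟨fun i => u i * A * z, ?_⟩
      have h1 : ∑ i, a j i * (u i * A * z) = Finset.gcd Finset.univ (a j) * A * z := by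
        rw [hu, Finset.sum_mul, Finset.sum_mul]
        exact Finset.sum_congr rfl fun i _ => by ring
      have h2 := congrArg (Int.cast : ℤ → ZMod (N j)) hbez
      push_cast at h2
      rw [ZMod.natCast_self, zero_mul, add_zero] at h2
      rw [hφ, h1]
      push_cast
      rw [← h2, one_mul]
    rw [AddSubgroup.index_ker, AddMonoidHom.range_eq_top.mpr hsurj]
    simp
  by_contra! hcon
  have hcover : ⋃ j ∈ (Finset.univ : Finset J),
      (0 : ι → ℤ) +ᵥ ((φ j).ker : Set (ι → ℤ)) = Set.univ := by
    refine Set.eq_univ_of_forall fun k => ?_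
    obtain ⟨j, hj⟩ := hcon k
    refine Set.mem_iUnion₂.mpr ⟨j, Finset.mem_univ j, ?_⟩
    rw [zero_vadd, SetLike.mem_coe, AddMonoidHom.mem_ker, hφ]
    exact (ZMod.intCast_zmod_eq_zero_iff_dvd _ _).mpr hj
  have hone := AddSubgroup.one_le_sum_inv_index_of_leftCoset_cover hcover
  simp only [hindex] at hone
  have hJ : Nonempty J := ⟨(hcon 0).choose⟩
  rcases subsingleton_or_nontrivial J with hsub | hnt
  · obtain ⟨j⟩ := hJ
    have : ∀ i : J, i = j := fun i => Subsingleton.elim i j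
    rw [Fintype.sum_eq_single j fun i hi => absurd (this i) hi] at hone
    have h2 : (2 : ℚ) ≤ N j := by exact_mod_cast hN j
    have : (N j : ℚ)⁻¹ ≤ 2⁻¹ := by gcongr
    norm_num at this
    linarith
  · have hcardpos : (0 : ℚ) < Fintype.card J := by exact_mod_cast Fintype.card_pos
    have hle : ∑ j, ((N j : ℚ))⁻¹ ≤ 1 := by
      calc ∑ j, ((N j : ℚ))⁻¹ ≤ ∑ _j : J, ((Fintype.card J : ℚ))⁻¹ := by
            refine Finset.sum_le_sum fun j _ => ?_
            have : (Fintype.card J : ℚ) ≤ N j := by exact_mod_cast hcard j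
            gcongr
        _ = 1 := by simp [hcardpos.ne']
    have hdisj := AddSubgroup.pairwiseDisjoint_leftCoset_cover_of_sum_neg_index_eq_zero hcover
      (by simp only [hindex]; exact le_antisymm hle hone)
    obtain ⟨i, j, hij⟩ := exists_pair_ne J
    have hfin : ∀ j, (φ j).ker.FiniteIndex := fun j =>
      ⟨by rw [hindex]; have := hN j; omega⟩
    have h := hdisj (x := i) (by simp [hfin]) (y := j) (by simp [hfin]) hij
    exact Set.not_disjoint_iff.mpr ⟨0, by simp, by simp⟩ h

lemma le_abs_intCast_add {t : ℝ} (ht : t ≤ 1 / 2) (q : ℤ) : t ≤ |(q : ℝ) + t| := by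
  rcases le_or_gt 0 q with hq | hq
  · have : (0 : ℝ) ≤ q := by exact_mod_cast hq
    exact le_abs.mpr (Or.inl (by linarith))
  · have : (q : ℝ) ≤ -1 := by exact_mod_cast Int.le_sub_one_of_lt hq
    exact le_abs.mpr (Or.inr (by linarith))

/-- A phase that is integral in the first `n` coordinates, far from the integers in the others,
and at which all the resonant combinations are far from their moduli. -/
lemma exists_nonresonant_phase {n r mh : ℕ} (hmh1 : 1 ≤ mh) (N : Fin mh → ℕ)
    (a : Fin mh → Fin (n + r) → ℤ) (hN1 : ∀ j, 1 ≤ N j)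
    (hgcd : ∀ j, Int.gcd (Finset.gcd Finset.univ (a j)) (N j : ℤ) = 1)
    (hNmh : ∀ j, mh ≤ N j)
    (hspec : mh = 1 → (∀ j, N j = 1) → ∃ i : Fin (n + r), n ≤ (i : ℕ) ∧ ∀ j, a j i ≠ 0)
    (b : ℕ) (hb : ∀ j, ∑ i, (a j i).natAbs ≤ b) :
    1 ≤ b ∧ ∃ y : Fin (n + r) → ℝ,
      (∀ i : Fin n, ∃ k : ℤ, y (Fin.castAdd r i) = k) ∧
      (∀ (i : Fin r) (p : ℤ), 1 / (2 * b : ℝ) ≤ |y (Fin.natAdd n i) - p|) ∧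
      ∀ (j : Fin mh) (p : ℤ), 1 / 2 ≤ |∑ i, (a j i : ℝ) * y i - N j * p| := by
  by_cases hN : ∀ j, 2 ≤ N j
  · have hb1 : 1 ≤ b := by
      by_contra! hlt
      have h0 := hb ⟨0, hmh1⟩
      have ha : ∀ i ∈ Finset.univ, a ⟨0, hmh1⟩ i = 0 := by
        intro i hi
        have := Finset.sum_eq_zero_iff.mp (by omega : ∑ i, (a ⟨0, hmh1⟩ i).natAbs = 0) i hi
        exact Int.natAbs_eq_zero.mp this
      have hg := hgcd ⟨0, hmh1⟩
      rw [Finset.gcd_eq_zero_iff.mpr ha, Int.gcd_zero_left, Int.natAbs_natCast] at hg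
      have := hN ⟨0, hmh1⟩
      omega
    refine ⟨hb1, ?_⟩
    have hbR : (1 : ℝ) ≤ b := by exact_mod_cast hb1
    obtain ⟨k, hk⟩ := exists_forall_not_dvd N a hN (by simpa using hNmh) hgcd
    set t : ℝ := 1 / (2 * b) with ht
    have ht0 : 0 ≤ t := by positivity
    have ht2 : t ≤ 1 / 2 := by
      rw [ht]
      gcongr
      linarith
    let e : Fin (n + r) → ℝ := Fin.append (fun _ => 0) (fun _ => t)
    have he : ∀ i, |e i| ≤ t := by
      refine Fin.addCases (fun i => ?_) (fun i => ?_)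
      · simpa [e] using ht0
      · simp [e, abs_of_nonneg ht0]
    refine ⟨fun i => k i + e i, fun i => ⟨k (Fin.castAdd r i), by simp [e]⟩, fun i p => ?_,
      fun j p => ?_⟩
    · have := le_abs_intCast_add ht2 (k (Fin.natAdd n i) - p)
      push_cast at this
      simp only [e, Fin.append_right]
      convert this using 2
      ring
    · have hint : (1 : ℝ) ≤ |((∑ i, a j i * k i - N j * p : ℤ) : ℝ)| := by
        rw [← Int.cast_abs]
        have h0 : ∑ i, a j i * k i - N j * p ≠ 0 := fun h => hk j ⟨p, sub_eq_zero.mp h⟩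
        exact_mod_cast Int.one_le_abs h0
      have hsmall : |∑ i, (a j i : ℝ) * e i| ≤ 1 / 2 := by
        calc |∑ i, (a j i : ℝ) * e i| ≤ ∑ i, |(a j i : ℝ) * e i| :=
              Finset.abs_sum_le_sum_abs _ _
          _ ≤ ∑ i, ((a j i).natAbs : ℝ) * t := by
              refine Finset.sum_le_sum fun i _ => ?_
              rw [abs_mul, Nat.cast_natAbs, Int.cast_abs]
              gcongr
              exact he i
          _ = ((∑ i, (a j i).natAbs : ℕ) : ℝ) * t := by
              rw [← Finset.sum_mul, Nat.cast_sum]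
          _ ≤ b * t := by
              gcongr
              exact hb j
          _ = 1 / 2 := by
              rw [ht]
              field_simp
      have hsplit : ∑ i, (a j i : ℝ) * (k i + e i) - N j * p =
          ((∑ i, a j i * k i - N j * p : ℤ) : ℝ) + ∑ i, (a j i : ℝ) * e i := by
        push_cast
        simp only [mul_add, Finset.sum_add_distrib]
        ring
      rw [hsplit]
      have := abs_sub_abs_le_abs_add ((∑ i, a j i * k i - N j * p : ℤ) : ℝ)
        (∑ i, (a j i : ℝ) * e i)
      linarith
  · push Not at hN
    obtain ⟨j₀, hj₀⟩ := hN
    obtain rfl : mh = 1 := by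
      have := hNmh j₀
      omega
    have hN' : ∀ j, N j = 1 := fun j => by
      have := hN1 j₀
      rw [Subsingleton.elim j j₀]
      omega
    obtain ⟨i₀, hi₀, hai₀⟩ := hspec rfl hN'
    let S : ℕ := ∑ i : Fin r, (a j₀ (Fin.natAdd n i)).natAbs
    have hSb : S ≤ b := by
      have := hb j₀
      rw [Fin.sum_univ_add] at this
      omega
    have hS1 : 1 ≤ S := by
      revert hi₀ hai₀
      refine Fin.addCases (fun i h _ => ?_) (fun i _ h => ?_) i₀
      · simp at h
        omega
      · exact (Int.natAbs_pos.mpr (h j₀)).trans_le (Finset.single_le_sum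
          (f := fun i => (a j₀ (Fin.natAdd n i)).natAbs) (by simp) (Finset.mem_univ i))
    refine ⟨hS1.trans hSb, ?_⟩
    have hSR : (1 : ℝ) ≤ S := by exact_mod_cast hS1
    have hSbR : (S : ℝ) ≤ b := by exact_mod_cast hSb
    set t : ℝ := 1 / (2 * S) with ht
    have ht0 : 0 ≤ t := by positivity
    have ht2 : t ≤ 1 / 2 := by
      rw [ht]
      gcongr
      linarith
    have hbt : 1 / (2 * b : ℝ) ≤ t := by
      rw [ht]
      gcongr
    let σ : ℤ → ℝ := fun z => if 0 ≤ z then 1 else -1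
    have hσ : ∀ z : ℤ, (z : ℝ) * (σ z * t) = z.natAbs * t := by
      intro z
      rw [Nat.cast_natAbs, Int.cast_abs]
      by_cases hz : 0 ≤ z
      · have : (0 : ℝ) ≤ z := by exact_mod_cast hz
        simp [σ, hz, abs_of_nonneg this]
      · have : (z : ℝ) < 0 := by exact_mod_cast not_le.mp hz
        simp [σ, hz, abs_of_neg this]
    refine ⟨Fin.append (fun _ => 0) fun i => σ (a j₀ (Fin.natAdd n i)) * t,
      fun i => ⟨0, by simp⟩, fun i p => hbt.trans ?_, fun j p => ?_⟩
    · rw [Fin.append_right]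
      by_cases hz : 0 ≤ a j₀ (Fin.natAdd n i)
      · have := le_abs_intCast_add ht2 (-p)
        push_cast at this
        rw [show σ (a j₀ (Fin.natAdd n i)) * t - p = -p + t by simp only [σ, hz, if_true]; ring]
        exact this
      · have := le_abs_intCast_add ht2 p
        rw [show σ (a j₀ (Fin.natAdd n i)) * t - p = -(p + t) by
          simp only [σ, hz, if_false]; ring, abs_neg]
        exact this
    · rw [Subsingleton.elim j j₀, hN' j₀, Fin.sum_univ_add]
      simp only [Fin.append_left, Fin.append_right, hσ, mul_zero, Finset.sum_const_zero, zero_add]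
      rw [← Finset.sum_mul, ← Nat.cast_sum]
      have hSt : (S : ℝ) * t = 1 / 2 := by
        rw [ht]
        field_simp
      change 1 / 2 ≤ |(S : ℝ) * t - _|
      rw [hSt]
      have := le_abs_intCast_add (t := 1 / 2) le_rfl (-p)
      push_cast at this ⊢
      convert this using 2
      ring

lemma distZ_le (x : ℝ) (p : ℤ) : distZ x ≤ |x - p| :=
  ciInf_le ⟨0, by rintro _ ⟨q, rfl⟩; exact abs_nonneg _⟩ p

lemma le_distZ {x c : ℝ} (h : ∀ p : ℤ, c ≤ |x - p|) : c ≤ distZ x := le_ciInf h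

/-- existence of a non-resonant time τ for a resonance structure with
1 ≤ mh ≤ m resonances, assuming M_j ≥ mh for all j and, in the case mh = 1, M₁ = 1,
that a₁ has a nonzero entry among the last m − mh components. -/
theorem nonresonant_time_with_resonances
    (n m : ℕ) (hn : 1 ≤ n) (hm : 1 ≤ m)
    (ω : Fin n → ℝ) (Ω : Fin m → ℝ)
    (mh : ℕ) (hmh1 : 1 ≤ mh) (hmhm : mh ≤ m)
    (ωh : Fin (n + (m - mh)) → ℝ)
    (hωh : ωh = Fin.append ω (fun i : Fin (m - mh) => Ω ⟨mh + (i : ℕ), by omega⟩))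
    (hindep : ∀ ℓ : Fin (n + (m - mh)) → ℤ, ℓ ≠ 0 → (∑ i, (ℓ i : ℝ) * ωh i) ≠ 0)
    (Mv : Fin mh → ℕ) (a : Fin mh → Fin (n + (m - mh)) → ℤ)
    (hMv1 : ∀ j, 1 ≤ Mv j)
    (hres : ∀ j : Fin mh, (Mv j : ℝ) * Ω ⟨(j : ℕ), by omega⟩ = ∑ i, (a j i : ℝ) * ωh i)
    (hgcd : ∀ j, Int.gcd (Finset.gcd Finset.univ (a j)) ((Mv j : ℤ)) = 1)
    (hMmh : ∀ j, mh ≤ Mv j)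
    (hspec : mh = 1 → (∀ j, Mv j = 1) →
      ∃ i : Fin (n + (m - mh)), n ≤ (i : ℕ) ∧ ∀ j, a j i ≠ 0)
    (β d₀ : ℝ) (M : ℕ)
    (hβ : β = 2 * ((Finset.univ.sup fun j => ∑ i, (a j i).natAbs : ℕ) : ℝ))
    (hd₀ : d₀ = min (1 / (2 * β)) (1 / (4 * ((Finset.univ.sup Mv : ℕ) : ℝ))))
    (hM : M = Finset.univ.lcm Mv)
    (δ : ℝ) (hδpos : 0 < δ) (hδβ : δ ≤ 1 / (2 * β))
    (t₀ : ℝ) (ht₀ : 0 < t₀) :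
    ∃ τ : ℝ, t₀ ≤ τ ∧
      ENNReal.ofReal (τ - t₀) ≤
        Terg (n + (m - mh)) (fun i => ωh i / (M : ℝ)) (δ / (M : ℝ)) ∧
      (∀ i : Fin n, distZ (ω i * τ) ≤ δ) ∧
      (∀ j : Fin m, d₀ ≤ distZ (Ω j * τ)) := by
  have hlen : ∀ j, ∑ i, (a j i).natAbs ≤ Finset.univ.sup fun j => ∑ i, (a j i).natAbs :=
    fun j => Finset.le_sup (f := fun j => ∑ i, (a j i).natAbs) (Finset.mem_univ j)
  obtain ⟨hb1, y, hyn, hym, hyres⟩ :=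
    exists_nonresonant_phase hmh1 Mv a hMv1 hgcd hMmh hspec _ hlen
  set b : ℕ := Finset.univ.sup fun j => ∑ i, (a j i).natAbs
  rw [← hβ] at hym
  have hbR : (1 : ℝ) ≤ b := by exact_mod_cast hb1
  have hβpos : 0 < β := by linarith
  have hM0 : M ≠ 0 := by
    rw [hM, Ne, Finset.lcm_eq_zero_iff]
    rintro ⟨j, -, hj⟩
    have := hMv1 j
    omega
  have hMR : (0 : ℝ) < M := by exact_mod_cast Nat.pos_of_ne_zero hM0
  obtain ⟨s, hs0, hsT, h, hh⟩ := exists_time_le_Terg (fun i => ωh i / (M : ℝ))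
    (fun ℓ hℓ hzero => hindep ℓ hℓ (by
      simp only [← mul_div_assoc, ← Finset.sum_div] at hzero
      exact (div_eq_zero_iff.mp hzero).resolve_right hMR.ne'))
    (div_pos hδpos hMR) (fun i => (y i - t₀ * ωh i) / M)
  have herr : ∀ i, |y i - ωh i * (t₀ + s) - M * h i| ≤ δ := by
    intro i
    have heq : y i - ωh i * (t₀ + s) - M * h i =
        ((y i - t₀ * ωh i) / M - s * (ωh i / M) - h i) * M := by
      field_simp
      ring
    rw [heq, abs_mul, abs_of_pos hMR]
    exact (le_div_iff₀ hMR).mp (hh i)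
  have hω : ∀ i : Fin n, ωh (Fin.castAdd (m - mh) i) = ω i := fun i => by
    rw [hωh, Fin.append_left]
  have hΩ : ∀ i : Fin (m - mh), ωh (Fin.natAdd n i) = Ω ⟨mh + (i : ℕ), by omega⟩ := fun i => by
    rw [hωh, Fin.append_right]
  refine ⟨t₀ + s, by linarith, by rwa [add_sub_cancel_left], fun i => ?_, fun j => ?_⟩
  · obtain ⟨k, hk⟩ := hyn i
    refine (distZ_le _ (k - M * h (Fin.castAdd (m - mh) i))).trans ?_
    have := herr (Fin.castAdd (m - mh) i)
    rw [hk, hω, ← abs_neg] at this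
    refine le_of_eq_of_le (congrArg _ ?_) this
    push_cast
    ring
  · refine le_distZ fun p => ?_
    rcases lt_or_ge (j : ℕ) mh with hj | hj
    · have hdvd : Mv ⟨j, hj⟩ ∣ M := hM ▸ Finset.dvd_lcm (Finset.mem_univ _)
      have hle : Mv ⟨j, hj⟩ ≤ Finset.univ.sup Mv := Finset.le_sup (Finset.mem_univ _)
      have hj1 := hMv1 ⟨j, hj⟩
      have hr := hres ⟨j, hj⟩
      have hy := hyres ⟨j, hj⟩
      have hl := hlen ⟨j, hj⟩
      generalize Mv ⟨j, hj⟩ = N at *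
      generalize a ⟨j, hj⟩ = c at *
      obtain ⟨q, hq⟩ := hdvd
      have hNR : (1 : ℝ) ≤ N := by exact_mod_cast hj1
      set e : Fin (n + (m - mh)) → ℝ := fun i => y i - ωh i * (t₀ + s) - M * h i with he
      have hesum : |∑ i, (c i : ℝ) * e i| ≤ 1 / 4 := by
        calc |∑ i, (c i : ℝ) * e i| ≤ ∑ i, |(c i : ℝ) * e i| := Finset.abs_sum_le_sum_abs _ _
          _ ≤ ∑ i, ((c i).natAbs : ℝ) * δ := by
              refine Finset.sum_le_sum fun i _ => ?_
              rw [abs_mul, Nat.cast_natAbs, Int.cast_abs]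
              gcongr
              exact herr i
          _ = ((∑ i, (c i).natAbs : ℕ) : ℝ) * δ := by rw [← Finset.sum_mul, Nat.cast_sum]
          _ ≤ b * (1 / (2 * β)) := by gcongr
          _ = 1 / 4 := by
              rw [hβ]
              field_simp
              norm_num
      have hsplit : ∑ i, (c i : ℝ) * y i -
            N * ((p + q * ∑ i, c i * h i : ℤ) : ℝ) - ∑ i, (c i : ℝ) * e i =
          N * (Ω j * (t₀ + s) - p) := by
        have hMq : (M : ℝ) = N * q := by rw [hq]; push_cast; ring
        have h1 : ∑ i, (c i : ℝ) * e i = ∑ i, (c i : ℝ) * y i -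
            (∑ i, (c i : ℝ) * ωh i) * (t₀ + s) - M * ∑ i, (c i : ℝ) * h i := by
          rw [Finset.sum_mul, Finset.mul_sum, ← Finset.sum_sub_distrib,
            ← Finset.sum_sub_distrib]
          exact Finset.sum_congr rfl fun i _ => by rw [he]; ring
        rw [h1, ← hr, hMq]
        push_cast
        ring
      have hmain : 1 / 4 ≤ N * |Ω j * (t₀ + s) - p| := by
        have hNabs : N * |Ω j * (t₀ + s) - p| = |N * (Ω j * (t₀ + s) - p)| := by
          rw [abs_mul, Nat.abs_cast]
        rw [hNabs, ← hsplit]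
        have h1 := hy (p + q * ∑ i, c i * h i)
        have h2 := abs_sub_abs_le_abs_sub
          (∑ i, (c i : ℝ) * y i - N * ((p + q * ∑ i, c i * h i : ℤ) : ℝ)) (∑ i, (c i : ℝ) * e i)
        linarith
      calc d₀ ≤ 1 / (4 * ((Finset.univ.sup Mv : ℕ) : ℝ)) := hd₀ ▸ min_le_right _ _
        _ ≤ 1 / (4 * N) := by gcongr
        _ ≤ |Ω j * (t₀ + s) - p| := by
            rw [div_le_iff₀ (by positivity)]
            linarith
    · have hjm : (j : ℕ) - mh < m - mh := by omega
      have hΩj := hΩ ⟨j - mh, hjm⟩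
      have hjj : (⟨mh + (j - mh), by omega⟩ : Fin m) = j := by
        ext
        simp only
        omega
      simp only [hjj] at hΩj
      have h1 := hym ⟨j - mh, hjm⟩ (p + M * h (Fin.natAdd n ⟨j - mh, hjm⟩))
      have h2 := herr (Fin.natAdd n ⟨j - mh, hjm⟩)
      rw [hΩj] at h2
      generalize Fin.natAdd n ⟨j - mh, hjm⟩ = i at *
      have h3 := abs_sub_abs_le_abs_sub (y i - ((p + M * h i : ℤ) : ℝ))
        (y i - Ω j * (t₀ + s) - M * h i)
      have h4 : y i - ((p + M * h i : ℤ) : ℝ) - (y i - Ω j * (t₀ + s) - M * h i) =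
          Ω j * (t₀ + s) - p := by
        push_cast
        ring
      rw [h4] at h3
      have h5 : d₀ ≤ 1 / (2 * β) := hd₀ ▸ min_le_left _ _
      have h6 : 1 / β = 1 / (2 * β) + 1 / (2 * β) := by
        field_simp
        norm_num
      linarith
end

section
/- Let n, m ≥ 1 and suppose the vector (ω, Ω) ∈ ℝ^{n+m} (with ω ∈ ℝⁿ, Ω ∈ ℝᵐ) is rationally independent. Then for every 0 < δ ≤ 1/4 and every t₀ > 0 there exists τ ≥ t₀ with τ − t₀ ≤ T_erg((ω, Ω), δ) such that dist(ω_i τ, ℤ) ≤ δ for all 1 ≤ i ≤ n and dist(Ω_j τ, ℤ) ≥ 1/4 for all 1 ≤ j ≤ m. -/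
open Real

open MeasureTheory Filter Topology UnitAddTorus

theorem integral_mFourier_of_ne_zero {ι : Type*} [Fintype ι] {n : ι → ℤ} (hn : n ≠ 0) :
    ∫ y, mFourier n y ∂(Measure.pi fun _ : ι => (AddCircle.haarAddCircle : Measure UnitAddCircle))
      = 0 := by
  obtain ⟨i, hi⟩ := Function.ne_iff.mp hn
  rw [mFourier, ContinuousMap.coe_mk,
    integral_fintype_prod_eq_prod (fun i (z : UnitAddCircle) => (fourier (n i) z : ℂ))]
  refine Finset.prod_eq_zero (Finset.mem_univ i) ?_
  exact integral_eq_zero_of_add_right_eq_neg (fourier_add_half_inv_index hi one_pos)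

theorem mFourier_coe_linear_flow {ι : Type*} [Fintype ι] (n : ι → ℤ) (ξ : ι → ℝ) (s : ℝ) :
    mFourier n (fun i => ((s * ξ i : ℝ) : UnitAddCircle)) =
      Complex.exp ((2 * π * Complex.I * (∑ i, (n i : ℝ) * ξ i : ℝ)) * s) := by
  simp only [mFourier, ContinuousMap.coe_mk, fourier_coe_apply]
  rw [← Complex.exp_sum]
  congr 1
  push_cast
  rw [Finset.mul_sum, Finset.sum_mul]
  refine Finset.sum_congr rfl fun i _ => ?_
  ring

theorem continuous_linear_flow {ι : Type*} (ξ : ι → ℝ) :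
    Continuous fun (s : ℝ) (i : ι) => ((s * ξ i : ℝ) : UnitAddCircle) :=
  continuous_pi fun _ => (AddCircle.continuous_mk' 1).comp (by fun_prop)

theorem tendsto_average_exp_atTop {c : ℝ} (hc : c ≠ 0) :
    Tendsto (fun N : ℕ => (N : ℂ)⁻¹ * ∫ s in (0 : ℝ)..N,
      Complex.exp ((2 * π * Complex.I * c) * s)) atTop (𝓝 0) := by
  have hc' : (2 * π * Complex.I * c : ℂ) ≠ 0 := by simp [hc, pi_ne_zero]
  simp_rw [integral_exp_mul_complex hc']
  refine (tendsto_inv_atTop_nhds_zero_nat (𝕜 := ℂ)).zero_mul_isBoundedUnder_le ?_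
  refine isBoundedUnder_of ⟨2 / ‖(2 * π * Complex.I * c : ℂ)‖, fun N => ?_⟩
  simp only [Function.comp_apply, norm_div]
  gcongr
  refine (norm_sub_le _ _).trans ?_
  have h (x : ℝ) : ‖Complex.exp (2 * π * Complex.I * c * x)‖ = 1 := by
    rw [Complex.norm_exp]; simp
  have h1 := h N
  have h2 := h 0
  rw [h1, h2]; norm_num

/-- Weyl equidistribution of a nonresonant linear flow, tested on trigonometric polynomials. -/
theorem tendsto_average_linear_flow {ι : Type*} [Fintype ι] {ξ : ι → ℝ}
    (hξ : ∀ ℓ : ι → ℤ, ℓ ≠ 0 → ∑ i, (ℓ i : ℝ) * ξ i ≠ 0) {g : C(UnitAddTorus ι, ℂ)}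
    (hg : g ∈ Submodule.span ℂ (Set.range (mFourier (d := ι)))) :
    Tendsto (fun N : ℕ => (N : ℂ)⁻¹ * ∫ s in (0 : ℝ)..N,
      g (fun i => ((s * ξ i : ℝ) : UnitAddCircle))) atTop
      (𝓝 (∫ y, g y ∂(Measure.pi fun _ : ι =>
        (AddCircle.haarAddCircle : Measure UnitAddCircle)))) := by
  have hint (g : C(UnitAddTorus ι, ℂ)) : Integrable g (Measure.pi fun _ : ι =>
      (AddCircle.haarAddCircle : Measure UnitAddCircle)) :=
    g.continuous.integrable_of_hasCompactSupport (HasCompactSupport.of_compactSpace _)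
  have hii (g : C(UnitAddTorus ι, ℂ)) (N : ℝ) : IntervalIntegrable
      (fun s => g (fun i => ((s * ξ i : ℝ) : UnitAddCircle))) volume 0 N :=
    (g.continuous.comp (continuous_linear_flow ξ)).intervalIntegrable _ _
  induction hg using Submodule.span_induction with
  | mem g hg =>
    obtain ⟨n, rfl⟩ := hg
    rcases eq_or_ne n 0 with rfl | hn
    · simp only [mFourier_zero, ContinuousMap.one_apply]
      refine tendsto_const_nhds.congr' ?_
      filter_upwards [eventually_ne_atTop 0] with N hN
      simp [hN]
    · rw [integral_mFourier_of_ne_zero hn]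
      simp_rw [mFourier_coe_linear_flow]
      exact tendsto_average_exp_atTop (hξ n hn)
  | zero => simp
  | add f g _ _ hf hg =>
    simp only [ContinuousMap.add_apply]
    rw [integral_add (hint f) (hint g)]
    refine (hf.add hg).congr fun N => ?_
    rw [intervalIntegral.integral_add (hii f N) (hii g N), mul_add]
  | smul a g _ hg =>
    simp only [ContinuousMap.smul_apply, smul_eq_mul]
    rw [integral_const_mul]
    refine (hg.const_mul a).congr fun N => ?_
    rw [intervalIntegral.integral_const_mul]
    ring

/-- Kronecker's theorem in continuous time: the forward orbit of a nonresonant linear flow on the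
torus is dense. -/
theorem exists_linear_flow_near {ι : Type*} [Fintype ι] {ξ : ι → ℝ}
    (hξ : ∀ ℓ : ι → ℤ, ℓ ≠ 0 → ∑ i, (ℓ i : ℝ) * ξ i ≠ 0) (x : UnitAddTorus ι) {δ : ℝ}
    (hδ : 0 < δ) : ∃ s : ℝ, 0 ≤ s ∧ ‖x - fun i => ((s * ξ i : ℝ) : UnitAddCircle)‖ ≤ δ := by
  by_contra! hfar
  let μ : Measure (UnitAddTorus ι) :=
    Measure.pi fun _ : ι => (AddCircle.haarAddCircle : Measure UnitAddCircle)
  let φ : UnitAddTorus ι → ℝ := fun y => max 0 (δ - ‖x - y‖)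
  have hφ : Continuous φ := by fun_prop
  have hpos : 0 < ∫ y, φ y ∂μ :=
    hφ.integral_pos_of_hasCompactSupport_nonneg_nonzero (x := x)
      (HasCompactSupport.of_compactSpace _) (fun y => le_max_left _ _) (by simp [φ, hδ])
  set c := ∫ y, φ y ∂μ with hc
  let f : C(UnitAddTorus ι, ℂ) := ⟨fun y => (φ y : ℂ), by fun_prop⟩
  have hf : ∫ y, f y ∂μ = c := integral_ofReal
  have hmem : f ∈ closure
      (Submodule.span ℂ (Set.range (mFourier (d := ι))) : Set C(UnitAddTorus ι, ℂ)) := by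
    rw [← Submodule.topologicalClosure_coe, span_mFourier_closure_eq_top]
    trivial
  obtain ⟨g, hg, hfg⟩ := Metric.mem_closure_iff.mp hmem (c / 3) (by positivity)
  rw [dist_eq_norm] at hfg
  have hle (y : UnitAddTorus ι) : ‖f y - g y‖ ≤ c / 3 :=
    ((f - g).norm_coe_le_norm y).trans hfg.le
  have hzero (s : ℝ) (hs : 0 ≤ s) : f (fun i => ((s * ξ i : ℝ) : UnitAddCircle)) = 0 := by
    simp only [f, φ, ContinuousMap.coe_mk, Complex.ofReal_eq_zero, max_eq_left_iff]
    linarith [hfar s hs]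
  have hgint : ‖∫ y, g y ∂μ‖ ≤ c / 3 := by
    refine le_of_tendsto (tendsto_average_linear_flow hξ hg).norm ?_
    filter_upwards [eventually_gt_atTop 0] with N hN
    have hN' : (0 : ℝ) < N := by exact_mod_cast hN
    have := intervalIntegral.norm_integral_le_of_norm_le_const (a := 0) (b := N) (C := c / 3)
      (f := fun s : ℝ => g (fun i => ((s * ξ i : ℝ) : UnitAddCircle))) (by
        intro s hs
        rw [Set.uIoc_of_le hN'.le] at hs
        simpa [hzero s hs.1.le] using hle (fun i => ((s * ξ i : ℝ) : UnitAddCircle)))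
    rw [sub_zero, abs_of_pos hN'] at this
    rw [norm_mul, norm_inv, Complex.norm_natCast, inv_mul_le_iff₀ hN']
    linarith
  have hint (g : C(UnitAddTorus ι, ℂ)) : Integrable g μ :=
    g.continuous.integrable_of_hasCompactSupport (HasCompactSupport.of_compactSpace _)
  have hdiff : ‖∫ y, f y ∂μ - ∫ y, g y ∂μ‖ ≤ c / 3 := by
    rw [← integral_sub (hint f) (hint g)]
    simpa using norm_integral_le_of_norm_le_const (μ := μ) (Eventually.of_forall hle)
  have hfc : ‖∫ y, f y ∂μ‖ = c := by
    rw [hf, Complex.norm_real, Real.norm_of_nonneg hpos.le]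
  have := norm_sub_norm_le (∫ y, f y ∂μ) (∫ y, g y ∂μ)
  linarith

theorem UnitAddCircle.norm_coe_le_iff {a δ : ℝ} :
    ‖(a : UnitAddCircle)‖ ≤ δ ↔ ∃ p : ℤ, |a - p| ≤ δ := by
  rw [UnitAddCircle.norm_eq]
  exact ⟨fun h => ⟨_, h⟩, fun ⟨p, hp⟩ => (round_le a p).trans hp⟩

/-- A nonresonant linear flow visits the closed `δ`-neighbourhood of any point of the torus at some
time bounded by the ergodization time. -/
theorem exists_near_of_le_Terg {d : ℕ} {ξ : Fin d → ℝ}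
    (hξ : ∀ ℓ : Fin d → ℤ, ℓ ≠ 0 → ∑ i, (ℓ i : ℝ) * ξ i ≠ 0) {δ : ℝ} (hδ : 0 < δ)
    (x : Fin d → ℝ) :
    ∃ s : ℝ, 0 ≤ s ∧ ENNReal.ofReal s ≤ Terg d ξ δ ∧
      ∀ i, ∃ p : ℤ, |x i - s * ξ i - p| ≤ δ := by
  let S : Set ℝ := {s | 0 ≤ s ∧
    ‖(fun i => (x i : UnitAddCircle)) - fun i => ((s * ξ i : ℝ) : UnitAddCircle)‖ ≤ δ}
  have hmem (s : ℝ) : s ∈ S ↔ 0 ≤ s ∧ ∀ i, ∃ p : ℤ, |x i - s * ξ i - p| ≤ δ := by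
    refine and_congr_right fun _ => ?_
    rw [pi_norm_le_iff_of_nonneg hδ.le]
    refine forall_congr' fun i => ?_
    rw [Pi.sub_apply, ← AddCircle.coe_sub, UnitAddCircle.norm_coe_le_iff]
  have hclosed : IsClosed S := isClosed_Ici.inter
    (isClosed_le (continuous_const.sub (continuous_linear_flow ξ)).norm continuous_const)
  have hbdd : BddBelow S := ⟨0, fun s hs => hs.1⟩
  obtain ⟨h0, hnear⟩ := (hmem _).1 (hclosed.csInf_mem (exists_linear_flow_near hξ _ hδ) hbdd)
  refine ⟨sInf S, h0, ?_, hnear⟩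
  refine le_iInf₂ fun t ht => ENNReal.ofReal_le_ofReal ?_
  obtain ⟨s, hs, h, hsh⟩ := ht.2 x
  exact (csInf_le hbdd ((hmem s).2 ⟨hs.1, fun i => ⟨h i, hsh i⟩⟩)).trans hs.2

/-- if (ω, Ω) ∈ ℝ^{n+m} is rationally independent, then for every
0 < δ ≤ 1/4 and t₀ > 0 there is τ ≥ t₀, with τ − t₀ ≤ T_erg((ω,Ω), δ), such that
dist(ωᵢτ, ℤ) ≤ δ for all i and dist(Ωⱼτ, ℤ) ≥ 1/4 for all j. -/
theorem nonresonant_time_rationally_independent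
    (n m : ℕ) (hn : 1 ≤ n) (hm : 1 ≤ m) (ω : Fin n → ℝ) (Ω : Fin m → ℝ)
    (hindep : ∀ ℓ : Fin (n + m) → ℤ, ℓ ≠ 0 →
      (∑ i, (ℓ i : ℝ) * (Fin.append ω Ω) i) ≠ 0)
    (δ : ℝ) (hδpos : 0 < δ) (hδ : δ ≤ 1 / 4) (t₀ : ℝ) (ht₀ : 0 < t₀) :
    ∃ τ : ℝ, t₀ ≤ τ ∧
      ENNReal.ofReal (τ - t₀) ≤ Terg (n + m) (Fin.append ω Ω) δ ∧
      (∀ i : Fin n, distZ (ω i * τ) ≤ δ) ∧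
      (∀ j : Fin m, 1 / 4 ≤ distZ (Ω j * τ)) := by
  obtain ⟨s, hs, hsT, hnear⟩ := exists_near_of_le_Terg hindep hδpos
    (Fin.append (fun i => -(t₀ * ω i)) fun j => 1 / 2 - t₀ * Ω j)
  refine ⟨t₀ + s, by linarith, by simpa using hsT, fun i => ?_, fun j => ?_⟩
  · obtain ⟨p, hp⟩ := hnear (Fin.castAdd m i)
    simp only [Fin.append_left] at hp
    have hτ : ω i * (t₀ + s) - ((-p : ℤ) : ℝ) = -(-(t₀ * ω i) - s * ω i - p) := by
      push_cast
      ring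
    refine (ciInf_le ⟨0, Set.forall_mem_range.2 fun _ => abs_nonneg _⟩ (-p)).trans ?_
    rwa [hτ, abs_neg]
  · obtain ⟨q, hq⟩ := hnear (Fin.natAdd n j)
    simp only [Fin.append_right] at hq
    refine le_ciInf fun p => ?_
    obtain ⟨h1, h2⟩ := abs_le.1 (hq.trans hδ)
    rcases le_or_gt (p + q) 0 with h | h
    · have : (p : ℝ) + q ≤ 0 := by exact_mod_cast h
      exact le_abs.2 (Or.inl (by linarith))
    · have : (1 : ℝ) ≤ p + q := by exact_mod_cast h
      exact le_abs.2 (Or.inr (by linarith))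
end

section
/- Let m̂, n̂ ≥ 1, let ω̂ ∈ ℝ^n̂ be rationally independent, and let Ω̂ ∈ ℝ^m̂ be such that for each 1 ≤ j ≤ m̂ there are M_j ∈ ℕ, M_j ≥ 1, and a_j ∈ ℤ^n̂ with M_j Ω̂_j = a_j · ω̂ and gcd(a_{j1}, …, a_{j n̂}, M_j) = 1. Let M := lcm(M₁, …, M_m̂) and K := {0, 1, …, M−1}^n̂. Suppose M_j ≥ m̂ for all 1 ≤ j ≤ m̂ and, in the case m̂ = 1, suppose moreover M₁ ≥ 2. Then there exists k ∈ K such that a_j · k / M_j ∉ ℤ (equivalently, M_j does not divide a_j · k) for every 1 ≤ j ≤ m̂. -/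
open scoped Pointwise in
/-- A group is not the union of `n` proper subgroups each of finite index at least `n`. -/
theorem AddSubgroup.exists_forall_notMem_of_card_le_index {G ι : Type*} [AddGroup G] [Fintype ι]
    (H : ι → AddSubgroup G) [∀ i, (H i).FiniteIndex] (hne : ∀ i, H i ≠ ⊤)
    (hcard : ∀ i, Fintype.card ι ≤ (H i).index) : ∃ x, ∀ i, x ∉ H i := by
  classical
  by_contra! hcover
  have hcovers : ⋃ i ∈ (Finset.univ : Finset ι), (0 : G) +ᵥ (H i : Set G) = Set.univ := by
    simpa [Set.eq_univ_iff_forall] using hcover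
  obtain ⟨i₀, -⟩ := hcover 0
  have : Nonempty ι := ⟨i₀⟩
  have hpos : (0 : ℚ) < Fintype.card ι := by exact_mod_cast Fintype.card_pos
  have hle : ∑ i, ((H i).index : ℚ)⁻¹ ≤ 1 := by
    calc ∑ i, ((H i).index : ℚ)⁻¹ ≤ ∑ _i : ι, (Fintype.card ι : ℚ)⁻¹ :=
          Finset.sum_le_sum fun i _ => inv_anti₀ hpos (by exact_mod_cast hcard i)
      _ = 1 := by simp [hpos.ne']
  have hdisj := pairwiseDisjoint_leftCoset_cover_of_sum_neg_index_eq_zero hcovers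
    (le_antisymm hle (one_le_sum_inv_index_of_leftCoset_cover hcovers))
  have heq : ∀ i, i = i₀ := by
    intro i
    by_contra hi
    have h := hdisj (by simpa using ‹∀ i, (H i).FiniteIndex› i)
      (by simpa using ‹∀ i, (H i).FiniteIndex› i₀) hi
    exact Set.disjoint_left.mp h (by simp : (0 : G) ∈ _) (by simp)
  refine hne i₀ (eq_top_iff.mpr fun x _ => ?_)
  obtain ⟨i, hi⟩ := hcover x
  exact heq i ▸ hi

/-- The map `k ↦ a · k` from `ℤ^ι` to `ℤ/m`. -/
def dotProductZMod {ι : Type*} [Fintype ι] (m : ℕ) (a : ι → ℤ) : (ι → ℤ) →+ ZMod m where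
  toFun k := ((a ⬝ᵥ k : ℤ) : ZMod m)
  map_zero' := by simp
  map_add' x y := by simp [dotProduct_add]

theorem dotProductZMod_eq_zero_iff {ι : Type*} [Fintype ι] {m : ℕ} {a k : ι → ℤ} :
    dotProductZMod m a k = 0 ↔ (m : ℤ) ∣ ∑ i, a i * k i :=
  ZMod.intCast_zmod_eq_zero_iff_dvd _ m

theorem dotProductZMod_surjective {ι : Type*} [Fintype ι] {m : ℕ} {a : ι → ℤ}
    (h : Int.gcd (Finset.univ.gcd a) m = 1) : Function.Surjective (dotProductZMod m a) := by
  intro y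
  obtain ⟨t, rfl⟩ := ZMod.intCast_surjective y
  obtain ⟨c, hc⟩ := Finset.univ.gcd_eq_sum_mul a
  obtain ⟨u, v, huv⟩ := Int.isCoprime_iff_gcd_eq_one.mpr h
  refine ⟨(u * t) • c, ?_⟩
  have hdot : a ⬝ᵥ c = Finset.univ.gcd a := hc.symm
  have hval : a ⬝ᵥ ((u * t) • c) = t - m * (v * t) := by
    rw [dotProduct_smul, hdot, smul_eq_mul]
    linear_combination t * huv
  change ((a ⬝ᵥ ((u * t) • c) : ℤ) : ZMod m) = t
  rw [hval]
  simp

theorem index_ker_dotProductZMod {ι : Type*} [Fintype ι] {m : ℕ} {a : ι → ℤ}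
    (h : Int.gcd (Finset.univ.gcd a) m = 1) : (dotProductZMod m a).ker.index = m := by
  rw [AddSubgroup.index_ker, AddMonoidHom.range_eq_top.mpr (dotProductZMod_surjective h)]
  simp

/-- given resonances M_j Ωh_j = a_j·ωh with gcd(a_j, M_j) = 1,
M_j ≥ mh for all j (and M₁ ≥ 2 if mh = 1), there exists k ∈ {0,…,M−1}^nh,
M = lcm(M₁,…,M_mh), with M_j ∤ a_j·k for every j. -/
theorem exists_nonresonant_lattice_point
    (mh nh : ℕ) (hmh : 1 ≤ mh) (hnh : 1 ≤ nh)
    (ωh : Fin nh → ℝ)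
    (hindep : ∀ ℓ : Fin nh → ℤ, ℓ ≠ 0 → (∑ i, (ℓ i : ℝ) * ωh i) ≠ 0)
    (Ωh : Fin mh → ℝ) (Mv : Fin mh → ℕ) (a : Fin mh → Fin nh → ℤ)
    (hMv1 : ∀ j, 1 ≤ Mv j)
    (hres : ∀ j, (Mv j : ℝ) * Ωh j = ∑ i, (a j i : ℝ) * ωh i)
    (hgcd : ∀ j, Int.gcd (Finset.gcd Finset.univ (a j)) ((Mv j : ℤ)) = 1)
    (M : ℕ) (hM : M = Finset.univ.lcm Mv)
    (hMmh : ∀ j, mh ≤ Mv j)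
    (hM1 : mh = 1 → ∀ j, 2 ≤ Mv j) :
    ∃ k : Fin nh → Fin M, ∀ j, ¬ ((Mv j : ℤ) ∣ ∑ i, a j i * ((k i : ℕ) : ℤ)) := by
  have hindex j := index_ker_dotProductZMod (hgcd j)
  have hfin j : (dotProductZMod (Mv j) (a j)).ker.FiniteIndex :=
    ⟨by rw [hindex]; exact (Nat.pos_iff_ne_zero.mp (hMv1 j))⟩
  obtain ⟨x, hx⟩ := AddSubgroup.exists_forall_notMem_of_card_le_index
    (fun j => (dotProductZMod (Mv j) (a j)).ker)
    (fun j htop => by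
      have hone := hindex j
      rw [htop, AddSubgroup.index_top] at hone
      have := hMmh j
      have := hM1 (by omega) j
      omega)
    (fun j => by simpa [hindex j] using hMmh j)
  have hM0 : M ≠ 0 := by
    rw [hM, Ne, Finset.lcm_eq_zero_iff]
    rintro ⟨j, -, hj⟩
    exact (Nat.pos_iff_ne_zero.mp (hMv1 j)) hj
  have hMpos : (0 : ℤ) < M := by omega
  have hmod i : (((x i % M).toNat : ℕ) : ℤ) = x i % M :=
    Int.toNat_of_nonneg (Int.emod_nonneg _ hMpos.ne')
  refine ⟨fun i => ⟨(x i % M).toNat, ?_⟩, fun j hdvd => hx j ?_⟩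
  · have := Int.emod_lt_of_pos (x i) hMpos
    have := hmod i
    omega
  · have hMj : (Mv j : ℤ) ∣ M := by
      exact_mod_cast hM ▸ Finset.dvd_lcm (Finset.mem_univ j)
    simp only [hmod] at hdvd
    rw [AddMonoidHom.mem_ker, dotProductZMod_eq_zero_iff]
    refine (dvd_iff_dvd_of_dvd_sub ?_).mpr hdvd
    rw [← Finset.sum_sub_distrib]
    refine Finset.dvd_sum fun i _ => ?_
    rw [← mul_sub]
    exact (hMj.trans (Int.dvd_self_sub_emod)).mul_left _
end

section
/- Let m ≥ 1 be an integer, let x ∈ ℝ, let ξ ∈ ℝ with ξ ≠ 0, let 0 < α ≤ |ξ|, and let J₁ ⊂ ℝ be an interval of length Δ > 0. Then: (i) if |ξ|Δ ≥ π, the Lebesgue measure of {T ∈ J₁ : dist(x + ξT, 2πℤ) ≤ π/(8m)} is at most Δ/(2m); (ii) if |ξ|Δ < π, the Lebesgue measure of {T ∈ J₁ : dist(x + ξT, 2πℤ) ≤ Δα/(4m)} is at most Δ/(2m). -/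
open Real MeasureTheory

/-- dist(x, 2πℤ) -/
noncomputable def distTwoPiZ (x : ℝ) : ℝ := ⨅ p : ℤ, |x - 2 * π * (p : ℝ)|

/-- The infimum defining `distTwoPiZ` is attained. -/
lemma exists_abs_sub_le_distTwoPiZ (y : ℝ) : ∃ p : ℤ, |y - 2 * π * p| ≤ distTwoPiZ y := by
  have hpi : (0 : ℝ) < 2 * π := by positivity
  have key (q : ℤ) : |y - 2 * π * q| = 2 * π * |y / (2 * π) - q| := by
    rw [← abs_of_pos hpi, ← abs_mul, abs_of_pos hpi]
    congr 1
    field_simp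
  refine ⟨round (y / (2 * π)), le_ciInf fun q => ?_⟩
  rw [key, key]
  exact mul_le_mul_of_nonneg_left (round_le _ _) hpi.le

/-- On an interval over which the phase `x + ξ T` varies by at most `π`, only one element of `2πℤ`
can be `δ`-close to the phase. -/
lemma volume_Icc_distTwoPiZ_le {x ξ δ a h : ℝ} (hξ : ξ ≠ 0) (hh : |ξ| * h ≤ π) (hδ : δ < π / 2) :
    volume {T ∈ Set.Icc a (a + h) | distTwoPiZ (x + ξ * T) ≤ δ} ≤
      ENNReal.ofReal (2 * (δ / |ξ|)) := by
  rcases Set.eq_empty_or_nonempty {T ∈ Set.Icc a (a + h) | distTwoPiZ (x + ξ * T) ≤ δ}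
    with h0 | ⟨S, hS, hSd⟩
  · rw [h0, measure_empty]
    exact zero_le
  have hξ' : 0 < |ξ| := abs_pos.mpr hξ
  obtain ⟨p, hp⟩ := exists_abs_sub_le_distTwoPiZ (x + ξ * S)
  rw [← Real.volume_closedBall ((2 * π * p - x) / ξ)]
  refine measure_mono ?_
  rintro T ⟨hT, hTd⟩
  obtain ⟨q, hq⟩ := exists_abs_sub_le_distTwoPiZ (x + ξ * T)
  have hTS : |ξ * (T - S)| ≤ π := by
    rw [abs_mul]
    refine (mul_le_mul_of_nonneg_left ?_ hξ'.le).trans hh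
    rw [abs_le]
    constructor <;> linarith [hT.1, hT.2, hS.1, hS.2]
  have hqp : q = p := by
    have h1 := abs_le.mp (hq.trans hTd)
    have h2 := abs_le.mp (hp.trans hSd)
    have h3 := abs_le.mp hTS
    have h4 : (q : ℝ) - p < 1 := by
      by_contra! hc
      nlinarith [pi_pos]
    have h5 : (p : ℝ) - q < 1 := by
      by_contra! hc
      nlinarith [pi_pos]
    have h6 : q - p < 1 := by exact_mod_cast h4
    have h7 : p - q < 1 := by exact_mod_cast h5
    omega
  subst hqp
  rw [Metric.mem_closedBall, Real.dist_eq, le_div_iff₀ hξ', ← abs_mul, sub_mul,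
    div_mul_cancel₀ _ hξ]
  refine (congrArg abs ?_).trans_le (hq.trans hTd)
  ring

lemma volume_Icc_nat_mul_distTwoPiZ_le {x ξ δ a h : ℝ} (hξ : ξ ≠ 0) (hh : |ξ| * h ≤ π)
    (hδ₀ : 0 ≤ δ) (hδ : δ < π / 2) (n : ℕ) :
    volume {T ∈ Set.Icc a (a + n * h) | distTwoPiZ (x + ξ * T) ≤ δ} ≤
      ENNReal.ofReal (n * (2 * (δ / |ξ|))) := by
  induction n with
  | zero =>
    refine (measure_mono (Set.sep_subset _ _)).trans ?_
    simp
  | succ n ih =>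
    have hsub : {T ∈ Set.Icc a (a + (n + 1 : ℕ) * h) | distTwoPiZ (x + ξ * T) ≤ δ} ⊆
        {T ∈ Set.Icc a (a + n * h) | distTwoPiZ (x + ξ * T) ≤ δ} ∪
        {T ∈ Set.Icc (a + n * h) (a + n * h + h) | distTwoPiZ (x + ξ * T) ≤ δ} := by
      rintro T ⟨⟨h1, h2⟩, h3⟩
      push_cast at h2
      rcases le_total T (a + n * h) with hT | hT
      · exact Or.inl ⟨⟨h1, hT⟩, h3⟩
      · exact Or.inr ⟨⟨hT, by linarith⟩, h3⟩
    refine (measure_mono hsub).trans <| (measure_union_le _ _).trans <|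
      (add_le_add ih (volume_Icc_distTwoPiZ_le hξ hh hδ)).trans_eq ?_
    rw [← ENNReal.ofReal_add (by positivity) (by positivity)]
    push_cast
    ring_nf

/-- An interval of length `Δ` is contained in a compact interval of length `Δ`. -/
lemma Set.OrdConnected.exists_subset_Icc_of_volume_le {J : Set ℝ} (hJ : J.OrdConnected) {Δ : ℝ}
    (hΔ : 0 ≤ Δ) (hvol : volume J ≤ ENNReal.ofReal Δ) : ∃ a, J ⊆ Set.Icc a (a + Δ) := by
  rcases J.eq_empty_or_nonempty with rfl | hne
  · exact ⟨0, Set.empty_subset _⟩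
  have hd {s t : ℝ} (hs : s ∈ J) (ht : t ∈ J) : t - Δ ≤ s := by
    have := (measure_mono (hJ.out hs ht)).trans hvol
    rw [Real.volume_Icc, ENNReal.ofReal_le_ofReal_iff hΔ] at this
    linarith
  obtain ⟨t₀, ht₀⟩ := hne
  refine ⟨sInf J, fun t ht => ⟨csInf_le ⟨t₀ - Δ, fun s hs => hd hs ht₀⟩ ht, ?_⟩⟩
  linarith [le_csInf ⟨t₀, ht₀⟩ fun s hs => hd hs ht]

/-- measure estimate for the sublevel sets of T ↦ dist(x + ξT, 2πℤ)
on an interval J₁ of length Δ. -/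
theorem measure_resonant_times
    (m : ℕ) (hm : 1 ≤ m) (x ξ α Δ : ℝ)
    (hξ : ξ ≠ 0) (hα : 0 < α) (hαξ : α ≤ |ξ|)
    (J₁ : Set ℝ) (hconn : J₁.OrdConnected)
    (hΔ : 0 < Δ) (hvol : volume J₁ = ENNReal.ofReal Δ) :
    (π ≤ |ξ| * Δ →
      volume {T ∈ J₁ | distTwoPiZ (x + ξ * T) ≤ π / (8 * m)} ≤
        ENNReal.ofReal (Δ / (2 * m))) ∧
    (|ξ| * Δ < π →
      volume {T ∈ J₁ | distTwoPiZ (x + ξ * T) ≤ Δ * α / (4 * m)} ≤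
        ENNReal.ofReal (Δ / (2 * m))) := by
  obtain ⟨a, ha⟩ := hconn.exists_subset_Icc_of_volume_le hΔ.le hvol.le
  have hm' : (1 : ℝ) ≤ m := by exact_mod_cast hm
  have hξ' : 0 < |ξ| := abs_pos.mpr hξ
  have hpi := pi_pos
  constructor
  · intro hL
    set n := ⌈|ξ| * Δ / π⌉₊
    have hn1 : |ξ| * Δ / π ≤ n := Nat.le_ceil _
    have hn2 : (n : ℝ) < |ξ| * Δ / π + 1 := Nat.ceil_lt_add_one (by positivity)
    have hL1 : 1 ≤ |ξ| * Δ / π := (one_le_div hpi).mpr hL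
    have hn0 : (0 : ℝ) < n := by linarith
    have hh : |ξ| * (Δ / n) ≤ π := by
      rw [← mul_div_assoc, div_le_iff₀ hn0]
      linarith [(div_le_iff₀ hpi).mp hn1]
    have hδ : π / (8 * m) < π / 2 := by
      apply div_lt_div_of_pos_left hpi <;> linarith
    have key := volume_Icc_nat_mul_distTwoPiZ_le (x := x) (a := a) hξ hh (by positivity) hδ n
    rw [mul_div_cancel₀ Δ hn0.ne'] at key
    refine (measure_mono (Set.inter_subset_inter_left _ ha)).trans (key.trans ?_)
    apply ENNReal.ofReal_le_ofReal
    calc n * (2 * (π / (8 * m) / |ξ|))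
        ≤ (2 * (|ξ| * Δ / π)) * (2 * (π / (8 * m) / |ξ|)) := by
          gcongr
          linarith
      _ = Δ / (2 * m) := by
          field_simp
          ring
  · intro hL
    have hδ : Δ * α / (4 * m) < π / 2 := by
      rw [div_lt_iff₀ (by positivity)]
      nlinarith
    refine (measure_mono (Set.inter_subset_inter_left _ ha)).trans
      ((volume_Icc_distTwoPiZ_le hξ hL.le hδ).trans ?_)
    apply ENNReal.ofReal_le_ofReal
    calc 2 * (Δ * α / (4 * m) / |ξ|) ≤ 2 * (Δ * |ξ| / (4 * m) / |ξ|) := by gcongr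
      _ = Δ / (2 * m) := by
          field_simp
          ring
end

section
/- Let n, m ≥ 1, γ, τ > 0 and let ω ∈ ℝⁿ, Ω ∈ ℝᵐ satisfy the second-order Melnikov conditions with constants γ, τ. Let (k, a, ā, ℓ) ∈ ℕⁿ × ℕᵐ × ℕᵐ × ℤⁿ satisfy 3 ≤ 2|k| + |a + ā| ≤ 5 and (k, a, ā, ℓ) ∉ S, where |k| := Σᵢ kᵢ, |a + ā| := Σⱼ (aⱼ + āⱼ), and S := S₁ ∪ S₂⁰ ∪ S₂¹ ∪ S₂² ∪ S₃ with S₁ := {(k,a,ā,ℓ) : k = 0, |a+ā| = 3}, S₂⁰ := {(k,a,ā,ℓ) : k = 0, |a+ā| = 4}, S₂¹ := {(k,a,ā,ℓ) : k = e_i for some 1 ≤ i ≤ n, a = ā = e_j for some 1 ≤ j ≤ m, ℓ = 0}, S₂² := {(k,a,ā,ℓ) : |k| = 2, a = ā = 0, ℓ = 0}, S₃ := {(k,a,ā,ℓ) : 2|k| + |a+ā| = 5 and |a+ā| ∈ {3,5}} (ℓ unrestricted in S₁, S₂⁰, S₃). Then |ω·ℓ + Ω·(a − ā)| ≥ γ/(1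 + |ℓ|₁^τ). -/
/-- A family of natural numbers with sum one is a standard unit vector. -/
theorem exists_eq_pi_single_of_sum_eq_one {ι : Type*} [Fintype ι] [DecidableEq ι] (f : ι → ℕ)
    (hf : ∑ i, f i = 1) : ∃ i, f = Pi.single i 1 := by
  obtain ⟨i, -, hi⟩ := Finset.exists_ne_zero_of_sum_ne_zero (hf.trans_ne one_ne_zero)
  refine ⟨i, funext fun j => ?_⟩
  have hsum := Finset.add_sum_erase Finset.univ f (Finset.mem_univ i)
  rw [hf] at hsum
  rcases eq_or_ne j i with rfl | hj
  · rw [Pi.single_eq_same]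
    omega
  · rw [Pi.single_eq_of_ne hj]
    have hle := Finset.single_le_sum (f := f) (fun _ _ => Nat.zero_le _)
      (Finset.mem_erase.2 ⟨hj, Finset.mem_univ j⟩)
    omega

/-- for (ω, Ω) satisfying the second-order Melnikov conditions and any
multi-index (k, a, abar, ℓ) with 3 ≤ 2|k| + |a + abar| ≤ 5 lying outside the resonant
set S = S₁ ∪ S₂⁰ ∪ S₂¹ ∪ S₂² ∪ S₃, one has
|ω·ℓ + Ω·(a − abar)| ≥ γ/(1 + |ℓ|₁^τ). -/
theorem melnikov_outside_resonant_set
    (n m : ℕ) (hn : 1 ≤ n) (hm : 1 ≤ m) (γ τ : ℝ) (hγ : 0 < γ) (hτ : 0 < τ)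
    (ω : Fin n → ℝ) (Ω : Fin m → ℝ)
    (hMel : ∀ (ℓ : Fin n → ℤ) (h : Fin m → ℤ), (∑ j, |h j|) ≤ 2 →
      ¬(ℓ = 0 ∧ h = 0) →
      γ / (1 + (∑ i, ((ℓ i).natAbs : ℝ)) ^ τ) ≤
        |∑ i, (ℓ i : ℝ) * ω i + ∑ j, (h j : ℝ) * Ω j|)
    (k : Fin n → ℕ) (a abar : Fin m → ℕ) (ℓ : Fin n → ℤ)
    (hlow : 3 ≤ 2 * (∑ i, k i) + ∑ j, (a j + abar j))
    (hhigh : 2 * (∑ i, k i) + (∑ j, (a j + abar j)) ≤ 5)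
    (hS1 : ¬(k = 0 ∧ (∑ j, (a j + abar j)) = 3))
    (hS20 : ¬(k = 0 ∧ (∑ j, (a j + abar j)) = 4))
    (hS21 : ¬(∃ i : Fin n, ∃ j : Fin m,
      k = Pi.single i 1 ∧ a = Pi.single j 1 ∧ abar = Pi.single j 1 ∧ ℓ = 0))
    (hS22 : ¬((∑ i, k i) = 2 ∧ a = 0 ∧ abar = 0 ∧ ℓ = 0))
    (hS3 : ¬(2 * (∑ i, k i) + (∑ j, (a j + abar j)) = 5 ∧
      ((∑ j, (a j + abar j)) = 3 ∨ (∑ j, (a j + abar j)) = 5))) :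
    γ / (1 + (∑ i, ((ℓ i).natAbs : ℝ)) ^ τ) ≤
      |∑ i, (ℓ i : ℝ) * ω i + ∑ j, ((a j : ℝ) - (abar j : ℝ)) * Ω j| := by
  have hk0 : ∑ i, k i = 0 → k = 0 := fun h => funext fun i => by
    simpa using Finset.sum_eq_zero_iff.1 h i (Finset.mem_univ i)
  have hk : ∑ i, k i ≠ 0 := by
    intro h
    have h0 := hk0 h
    have h3 : ∑ j, (a j + abar j) ≠ 3 := fun h' => hS1 ⟨h0, h'⟩
    have h4 : ∑ j, (a j + abar j) ≠ 4 := fun h' => hS20 ⟨h0, h'⟩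
    omega
  have hA : ∑ j, (a j + abar j) ≤ 2 := by omega
  have hnorm : ∑ j, |(a j : ℤ) - (abar j : ℤ)| ≤ 2 := by
    calc ∑ j, |(a j : ℤ) - (abar j : ℤ)| ≤ ∑ j, ((a j + abar j : ℕ) : ℤ) :=
          Finset.sum_le_sum fun j _ => by rw [abs_le]; omega
      _ ≤ 2 := by exact_mod_cast hA
  have hne : ¬(ℓ = 0 ∧ (fun j => (a j : ℤ) - (abar j : ℤ)) = 0) := by
    rintro ⟨hℓ, hh⟩
    have hab : a = abar := funext fun j => by
      have hj := congrFun hh j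
      simp only [Pi.zero_apply] at hj
      omega
    subst hab
    rw [Finset.sum_add_distrib] at hlow hhigh hA
    by_cases ha : ∑ j, a j = 0
    · have ha0 : a = 0 := funext fun j => by
        simpa using Finset.sum_eq_zero_iff.1 ha j (Finset.mem_univ j)
      exact hS22 ⟨by omega, ha0, ha0, hℓ⟩
    · have hkex : ∑ i, k i = 1 := by omega
      have haex : ∑ j, a j = 1 := by omega
      obtain ⟨i, hi⟩ := exists_eq_pi_single_of_sum_eq_one k hkex
      obtain ⟨j, hj⟩ := exists_eq_pi_single_of_sum_eq_one a haex
      exact hS21 ⟨i, j, hi, hj, hj, hℓ⟩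
  simpa using hMel ℓ (fun j => (a j : ℤ) - (abar j : ℤ)) hnorm hne
end
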